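/- Let X be a real 2n×2n matrix such that the matrix Y = -X·J·Xᵀ·J has no zero and no negative real eigenvalues (i.e. no real number t ≤ 0 lies in the spectrum of Y). Then there exists a real skew-symmetric matrix A (Aᵀ = -A) and a real symplectic matrix S (S·J·Sᵀ = J) such that X = A·S. -/

import Mathlib

open Matrix

/-- The standard symplectic form matrix `J = [[0, -I_n], [I_n, 0]]`. -/
def symplJ (n : ℕ) : Matrix (Fin n ⊕ Fin n) (Fin n ⊕ Fin n) ℝ :=
  Matrix.fromBlocks 0 (-1) 1 0

/-- The block diagonal matrix `D = [[I_n, 0], [0, -I_n]]`. -/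
def Dmat (n : ℕ) : Matrix (Fin n ⊕ Fin n) (Fin n ⊕ Fin n) ℝ :=
  Matrix.fromBlocks 1 0 0 (-1)

open Polynomial in
/-- A non-real complex number spans `ℂ` together with `1`, and a positive real number has a real
square root; hence a complex number off the non-positive half-line has a square root which is a
real polynomial in it. -/
lemma Complex.exists_aeval_sq_eq (z : ℂ) (hz : ∀ t : ℝ, t ≤ 0 → z ≠ t) :
    ∃ p : ℝ[X], aeval z p ^ 2 = z := by
  by_cases him : z.im = 0
  · have hzr : z = (z.re : ℂ) := Complex.ext rfl (by simpa using him)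
    have hpos : 0 ≤ z.re := by
      by_contra! h
      exact hz _ h.le hzr
    refine ⟨C (Real.sqrt z.re), ?_⟩
    rw [aeval_C, Complex.coe_algebraMap, ← Complex.ofReal_pow, Real.sq_sqrt hpos, ← hzr]
  · obtain ⟨w, hw⟩ := IsAlgClosed.exists_pow_nat_eq z (n := 2) (by norm_num)
    refine ⟨C (w.re - w.im / z.im * z.re) + C (w.im / z.im) * X, ?_⟩
    have h : aeval z (C (w.re - w.im / z.im * z.re) + C (w.im / z.im) * X) = w := by
      simp only [map_add, map_mul, aeval_C, aeval_X, Complex.coe_algebraMap]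
      apply Complex.ext
      · simp only [Complex.add_re, Complex.re_ofReal_mul, Complex.ofReal_re]
        ring
      · simp only [Complex.add_im, Complex.im_ofReal_mul, Complex.ofReal_im]
        field_simp
        ring
    rw [h, hw]

open Polynomial in
lemma Irreducible.exists_dvd_sq_sub_X {f : ℝ[X]} (hf : Irreducible f)
    (hroot : ∀ t : ℝ, t ≤ 0 → ¬ f.IsRoot t) : ∃ p : ℝ[X], f ∣ p ^ 2 - X := by
  obtain ⟨z, hz⟩ := IsAlgClosed.exists_aeval_eq_zero ℂ f hf.degree_pos.ne'
  obtain ⟨p, hp⟩ := Complex.exists_aeval_sq_eq z (by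
    rintro t ht rfl
    refine hroot t ht ?_
    have h : (algebraMap ℝ ℂ) (f.eval t) = 0 := by
      rw [← hz, ← Complex.coe_algebraMap, aeval_algebraMap_apply_eq_algebraMap_eval]
    simpa using h)
  refine ⟨p, ?_⟩
  have hint : IsIntegral ℝ z := Algebra.IsIntegral.isIntegral z
  have hassoc := (minpoly.irreducible hint).associated_of_dvd hf (minpoly.dvd ℝ z hz)
  exact hassoc.symm.dvd.trans (minpoly.dvd ℝ z (by simp [hp]))

/-- Hensel lifting of square roots along powers of `f`. -/
lemma exists_pow_dvd_sq_sub {R : Type*} [CommRing R] {f a p₀ : R} (h2 : IsUnit (2 : R))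
    (ha : IsCoprime f a) (hp₀ : f ∣ p₀ ^ 2 - a) (k : ℕ) : ∃ p : R, f ^ (k + 1) ∣ p ^ 2 - a := by
  induction k with
  | zero => exact ⟨p₀, by simpa using hp₀⟩
  | succ k ih =>
    obtain ⟨p, c, hc⟩ := ih
    have hcop : IsCoprime f (2 * p) := by
      have h : IsCoprime f (p ^ 2) := by
        have : p ^ 2 = a + f * (f ^ k * c) := by linear_combination hc
        rw [this]
        exact IsCoprime.add_mul_left_right ha _
      exact IsCoprime.mul_right (isCoprime_one_right.of_isCoprime_of_dvd_right h2.dvd)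
        ((IsCoprime.pow_right_iff two_pos).1 h)
    obtain ⟨u, v, huv⟩ := hcop
    refine ⟨p - (p ^ 2 - a) * v, c * u + f ^ k * c ^ 2 * v ^ 2, ?_⟩
    have h1 : (p - (p ^ 2 - a) * v) ^ 2 - a
        = (p ^ 2 - a) * (1 - v * (2 * p)) + (p ^ 2 - a) ^ 2 * v ^ 2 := by ring
    rw [h1, hc, ← huv]
    ring

lemma IsCoprime.exists_mul_dvd_sq_sub {R : Type*} [CommRing R] {f g a p q : R}
    (h : IsCoprime f g) (hp : f ∣ p ^ 2 - a) (hq : g ∣ q ^ 2 - a) :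
    ∃ r : R, f * g ∣ r ^ 2 - a := by
  obtain ⟨u, v, huv⟩ := h
  obtain ⟨c, hc⟩ := hp
  obtain ⟨d, hd⟩ := hq
  refine ⟨p * (v * g) + q * (u * f), IsCoprime.mul_dvd ⟨u, v, huv⟩ ?_ ?_⟩
  · have h1 : p * (v * g) + q * (u * f) = p + f * (u * (q - p)) := by
      linear_combination p * huv
    rw [h1]
    exact ⟨c + 2 * p * (u * (q - p)) + f * (u * (q - p)) ^ 2, by linear_combination hc⟩
  · have h1 : p * (v * g) + q * (u * f) = q + g * (v * (p - q)) := by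
      linear_combination q * huv
    rw [h1]
    exact ⟨d + 2 * q * (v * (p - q)) + g * (v * (p - q)) ^ 2, by linear_combination hd⟩

open Polynomial in
/-- `X` is a square modulo every real polynomial without roots in `(-∞, 0]`. -/
lemma Polynomial.exists_dvd_sq_sub_X (f : ℝ[X])
    (hroot : ∀ t : ℝ, t ≤ 0 → ¬ f.IsRoot t) : ∃ p : ℝ[X], f ∣ p ^ 2 - X := by
  induction f using UniqueFactorizationMonoid.induction_on_coprime with
  | h0 => exact absurd (by simp [IsRoot]) (hroot 0 le_rfl)
  | h1 hx => exact ⟨0, hx.dvd⟩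
  | @hpr f i hf =>
    cases i with
    | zero => exact ⟨0, by simp⟩
    | succ k =>
      have hroot' : ∀ t : ℝ, t ≤ 0 → ¬ f.IsRoot t := fun t ht h =>
        hroot t ht (h.dvd (dvd_pow_self f k.succ_ne_zero))
      obtain ⟨p₀, hp₀⟩ := hf.irreducible.exists_dvd_sq_sub_X hroot'
      refine exists_pow_dvd_sq_sub ?_ ?_ hp₀ k
      · exact (isUnit_C (x := (2 : ℝ))).2 (by norm_num)
      · refine hf.irreducible.coprime_iff_not_dvd.2 fun h => ?_
        exact hroot' 0 le_rfl (IsRoot.dvd (p := X) (by simp) (hf.irreducible.dvd_symm irreducible_X h))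
  | @hcp f g hfg hf hg =>
    obtain ⟨p, hp⟩ := hf fun t ht h => hroot t ht (h.dvd (dvd_mul_right f g))
    obtain ⟨q, hq⟩ := hg fun t ht h => hroot t ht (h.dvd (dvd_mul_left g f))
    exact hfg.isCoprime.exists_mul_dvd_sq_sub hp hq

open Polynomial in
lemma Matrix.exists_aeval_sq_eq {ι : Type*} [Fintype ι] [DecidableEq ι] (Y : Matrix ι ι ℝ)
    (hY : ∀ t : ℝ, t ≤ 0 → t ∉ spectrum ℝ Y) : ∃ p : ℝ[X], aeval Y p ^ 2 = Y := by
  obtain ⟨p, c, hc⟩ := Y.charpoly.exists_dvd_sq_sub_X fun t ht h =>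
    hY t ht (Matrix.mem_spectrum_iff_isRoot_charpoly.2 h)
  refine ⟨p, ?_⟩
  have h := congrArg (aeval Y) hc
  rw [map_mul, aeval_self_charpoly, zero_mul, map_sub, map_pow, aeval_X] at h
  exact sub_eq_zero.1 h

open Polynomial in
lemma SemiconjBy.polynomial_aeval {R A : Type*} [CommSemiring R] [Semiring A] [Algebra R A]
    {a x y : A} (h : SemiconjBy a x y) (p : R[X]) :
    SemiconjBy a (aeval x p) (aeval y p) := by
  induction p using Polynomial.induction_on' with
  | add p q hp hq => simpa only [map_add] using hp.add_right hq
  | monomial k r =>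
    simp only [aeval_monomial]
    exact SemiconjBy.mul_right (Algebra.commutes r a).symm (h.pow_right k)

open Polynomial in
lemma Matrix.transpose_aeval {ι R : Type*} [Fintype ι] [DecidableEq ι] [CommRing R]
    (M : Matrix ι ι R) (p : R[X]) : (aeval M p)ᵀ = aeval Mᵀ p := by
  induction p using Polynomial.induction_on' with
  | add p q hp hq => simp only [map_add, Matrix.transpose_add, hp, hq]
  | monomial k r =>
    simp only [aeval_monomial, ← Algebra.smul_def, Matrix.transpose_smul, Matrix.transpose_pow]

lemma symplJ_mul_self (n : ℕ) : symplJ n * symplJ n = -1 := by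
  simp [symplJ, Matrix.fromBlocks_multiply, ← Matrix.fromBlocks_one, Matrix.fromBlocks_neg]

lemma symplJ_transpose (n : ℕ) : (symplJ n)ᵀ = -symplJ n := by
  simp [symplJ, Matrix.fromBlocks_transpose, Matrix.fromBlocks_neg]

/-- Corollary: if `Y = -X*J*X^T*J` has no real eigenvalue `t ≤ 0`, then `X = A * S` with `A` skew-symmetric and `S` symplectic. -/
theorem stmt_6 (n : ℕ) (X : Matrix (Fin n ⊕ Fin n) (Fin n ⊕ Fin n) ℝ)
    (hY : ∀ t : ℝ, t ≤ 0 → t ∉ spectrum ℝ (-(X * symplJ n * Xᵀ * symplJ n))) :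
    ∃ A S : Matrix (Fin n ⊕ Fin n) (Fin n ⊕ Fin n) ℝ,
      Aᵀ = -A ∧ S * symplJ n * Sᵀ = symplJ n ∧ X = A * S := by
  obtain ⟨p, hp⟩ := Matrix.exists_aeval_sq_eq _ hY
  have hJJ := symplJ_mul_self n
  have hJt := symplJ_transpose n
  set J := symplJ n
  set Y := -(X * J * Xᵀ * J) with hYdef
  set R := Polynomial.aeval Y p with hR
  have hJY : SemiconjBy J Y Yᵀ := by
    simp only [SemiconjBy, hYdef, Matrix.transpose_neg, Matrix.transpose_mul,
      Matrix.transpose_transpose, hJt]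
    noncomm_ring
  have hJR : J * R = Rᵀ * J := by
    rw [hR, Matrix.transpose_aeval]
    exact hJY.polynomial_aeval p
  have hRJ : J * Rᵀ = R * J := by
    calc J * Rᵀ = -(J * (Rᵀ * J) * J) := by simp [mul_assoc, hJJ]
      _ = -(J * J * R * J) := by rw [← hJR]; noncomm_ring
      _ = R * J := by simp [hJJ]
  have hXJX : X * J * Xᵀ = R * R * J := by
    rw [← sq, hp, hYdef, neg_mul, mul_assoc _ J J, hJJ]
    simp
  have hYu : IsUnit Y := by
    simpa [spectrum.zero_mem_iff] using hY 0 le_rfl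
  have hRu : IsUnit R := by
    rw [← hp] at hYu
    exact (isUnit_pow_iff two_ne_zero).1 hYu
  have hAt : (-(R * J))ᵀ = -(-(R * J)) := by
    rw [Matrix.transpose_neg, Matrix.transpose_mul, hJt, neg_mul, hRJ]
  have hAu : IsUnit (-(R * J)) :=
    (hRu.mul (IsUnit.of_mul_eq_one (-J) (by rw [mul_neg, hJJ, neg_neg]))).neg
  obtain ⟨A, hA⟩ := hAu
  have hAJA : X * J * Xᵀ = (A : Matrix _ _ ℝ) * J * (A : Matrix _ _ ℝ)ᵀ := by
    rw [hXJX, hA, hAt, neg_neg]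
    calc R * R * J = -(R * (J * J) * R * J) := by simp [hJJ]
      _ = _ := by noncomm_ring
  obtain ⟨B, hBA, hAB⟩ : ∃ B : Matrix (Fin n ⊕ Fin n) (Fin n ⊕ Fin n) ℝ,
      B * A = 1 ∧ A * B = 1 := ⟨_, A.inv_mul, A.mul_inv⟩
  have hAtBt : (A : Matrix _ _ ℝ)ᵀ * Bᵀ = 1 := by
    rw [← Matrix.transpose_mul, hBA, Matrix.transpose_one]
  refine ⟨A, B * X, hA ▸ hAt, ?_, by rw [← mul_assoc, hAB, one_mul]⟩
  calc B * X * J * (B * X)ᵀ = B * (X * J * Xᵀ) * Bᵀ := by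
        simp only [Matrix.transpose_mul, mul_assoc]
    _ = B * (A : Matrix _ _ ℝ) * J * ((A : Matrix _ _ ℝ)ᵀ * Bᵀ) := by
        rw [hAJA]
        simp only [mul_assoc]
    _ = J := by rw [hAtBt, hBA, one_mul, mul_one]
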